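/- Let φ ∈ C^∞(ℂⁿ, ℝ) and ε > 0 be such that Σ_{j,k} (∂²φ/∂z_j∂z̄_k)(z) ξ_j conj(ξ_k) ≥ ε|ξ|² for all z, ξ ∈ ℂⁿ. Fix q with 1 ≤ q ≤ n and t₀ > 0. Let u be a (0,q)-form on ℂⁿ × ℝ whose components u_J are Schwartz functions on ℝ^{2n+1} supported in K × ℝ for some compact K ⊂ ℂⁿ, and suppose the partial Fourier transforms satisfy û_J(z,t) = 0 whenever t < t₀ (for all J and z). Then ‖u‖² ≤ (1/(2qε t₀)) ( ‖∂̄_b u‖² + ‖∂̄_b^† u‖² ). -/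

import Mathlib

/-!
STATEMENT 8: Basic estimate on the spectral subspace for the Heisenberg-type
CR manifold `ℍ = ℂⁿ × ℝ`: if the complex Hessian of `φ` is bounded below by
`ε > 0` and the `(0,q)`-form `u` (`1 ≤ q ≤ n`, Schwartz components supported in
`K × ℝ`) has partial Fourier transform vanishing for `t < t₀`, then
`‖u‖² ≤ (1/(2qεt₀)) (‖∂̄_b u‖² + ‖∂̄_b^† u‖²)`.
-/

open MeasureTheory

noncomputable section

/-- The Wirtinger derivative `∂f/∂z_j` of `f : ℂⁿ → ℂ` at `z`. -/
def wirtZ {n : ℕ} (f : (Fin n → ℂ) → ℂ) (j : Fin n) (z : Fin n → ℂ) : ℂ :=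
  (1 / 2 : ℂ) * (lineDeriv ℝ f z (Pi.single j 1)
    - Complex.I * lineDeriv ℝ f z (Pi.single j Complex.I))

/-- The Wirtinger derivative `∂f/∂z̄_j` of `f : ℂⁿ → ℂ` at `z`. -/
def wirtZbar {n : ℕ} (f : (Fin n → ℂ) → ℂ) (j : Fin n) (z : Fin n → ℂ) : ℂ :=
  (1 / 2 : ℂ) * (lineDeriv ℝ f z (Pi.single j 1)
    + Complex.I * lineDeriv ℝ f z (Pi.single j Complex.I))

/-- `∂φ/∂z_j` for a real-valued `φ`. -/
def wirtZR {n : ℕ} (φ : (Fin n → ℂ) → ℝ) (j : Fin n) (z : Fin n → ℂ) : ℂ :=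
  wirtZ (fun w => (φ w : ℂ)) j z

/-- `∂φ/∂z̄_j` for a real-valued `φ`. -/
def wirtZbarR {n : ℕ} (φ : (Fin n → ℂ) → ℝ) (j : Fin n) (z : Fin n → ℂ) : ℂ :=
  wirtZbar (fun w => (φ w : ℂ)) j z

/-- The derivative `∂u/∂x` in the real variable of `u : ℂⁿ × ℝ → ℂ`. -/
def dX {n : ℕ} (u : (Fin n → ℂ) × ℝ → ℂ) (p : (Fin n → ℂ) × ℝ) : ℂ :=
  deriv (fun s => u (p.1, s)) p.2

/-- The CR vector field `Z̄_j = ∂/∂z̄_j − i (∂φ/∂z̄_j) ∂/∂x` acting on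
`u : ℂⁿ × ℝ → ℂ`. -/
def Zbar {n : ℕ} (φ : (Fin n → ℂ) → ℝ) (j : Fin n) (u : (Fin n → ℂ) × ℝ → ℂ) :
    (Fin n → ℂ) × ℝ → ℂ :=
  fun p => wirtZbar (fun w => u (w, p.2)) j p.1
    - Complex.I * wirtZbarR φ j p.1 * dX u p

/-- The vector field `Z_j = ∂/∂z_j + i (∂φ/∂z_j) ∂/∂x` acting on
`u : ℂⁿ × ℝ → ℂ`. -/
def Zorig {n : ℕ} (φ : (Fin n → ℂ) → ℝ) (j : Fin n) (u : (Fin n → ℂ) × ℝ → ℂ) :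
    (Fin n → ℂ) × ℝ → ℂ :=
  fun p => wirtZ (fun w => u (w, p.2)) j p.1
    + Complex.I * wirtZR φ j p.1 * dX u p

/-- Partial Fourier transform in the real variable:
`û(z,t) = ∫_ℝ e^{−itx} u(z,x) dx`. -/
def pft {n : ℕ} (u : (Fin n → ℂ) × ℝ → ℂ) (z : Fin n → ℂ) (t : ℝ) : ℂ :=
  ∫ x : ℝ, Complex.exp (-(Complex.I * t * x)) * u (z, x)

end


noncomputable section

/-- The Levi form `∂²φ/∂z_j ∂z̄_k` of the weight `φ`. -/
def leviForm {n : ℕ} (φ : (Fin n → ℂ) → ℝ) (j k : Fin n) (z : Fin n → ℂ) : ℂ :=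
  wirtZ (fun w => wirtZbarR φ k w) j z

/-- `∂̄_b` on `(0,m)`-forms, given by components
`(∂̄_b u)_{j₀…j_m} = Σ_k (−1)^k Z̄_{j_k} u_{j₀…ĵ_k…j_m}`. -/
def dbarb {n m : ℕ} (φ : (Fin n → ℂ) → ℝ)
    (w : (Fin m → Fin n) → ((Fin n → ℂ) × ℝ → ℂ)) :
    (Fin (m + 1) → Fin n) → ((Fin n → ℂ) × ℝ → ℂ) :=
  fun K p => ∑ k : Fin (m + 1),
    (-1 : ℂ) ^ (k : ℕ) * Zbar φ (K k) (w (fun i => K (k.succAbove i))) p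

/-- `∂̄_b^†` on `(0,m+1)`-forms, given by components
`(∂̄_b^† u)_I = −Σ_j Z_j u_{jI}`. -/
def dbarbAdj {n m : ℕ} (φ : (Fin n → ℂ) → ℝ)
    (w : (Fin (m + 1) → Fin n) → ((Fin n → ℂ) × ℝ → ℂ)) :
    (Fin m → Fin n) → ((Fin n → ℂ) × ℝ → ℂ) :=
  fun I p => -∑ j : Fin n, Zorig φ j (w (Fin.cons j I)) p

open Classical in
/-- The squared `L²` norm of a `(0,m)`-form:
`‖w‖² = Σ_{J strictly increasing} ∫ |w_J|²`. -/
def formNormSq {n m : ℕ} (w : (Fin m → Fin n) → ((Fin n → ℂ) × ℝ → ℂ)) : ℝ :=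
  ∑ J : Fin m → Fin n,
    if StrictMono J then ∫ p : (Fin n → ℂ) × ℝ, ‖w J p‖ ^ 2 else 0

end

section SkewFamilies

variable {ι V : Type*} [AddCommGroup V] [Module ℂ V]

/-- A family indexed by tuples that changes by the sign of a permutation of the tuple. -/
def IsSkew {m : ℕ} (w : (Fin m → ι) → V) : Prop :=
  ∀ (σ : Equiv.Perm (Fin m)) (J : Fin m → ι),
    w (J ∘ σ) = ((Equiv.Perm.sign σ : ℤ) : ℂ) • w J

/-- The alternating sum `K ↦ ∑ k, (-1)^k a_{K k, K without its k-th entry}`. -/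
def alternatingSum {m : ℕ} (a : ι → (Fin m → ι) → V) (K : Fin (m + 1) → ι) : V :=
  ∑ k : Fin (m + 1), (-1 : ℂ) ^ (k : ℕ) • a (K k) (fun i => K (k.succAbove i))

lemma sign_mul_self_complex {m : ℕ} (σ : Equiv.Perm (Fin m)) :
    ((Equiv.Perm.sign σ : ℤ) : ℂ) * ((Equiv.Perm.sign σ : ℤ) : ℂ) = 1 := by
  rcases Int.units_eq_one_or (Equiv.Perm.sign σ) with h | h <;> simp [h]

lemma sign_cycleRange_complex {m : ℕ} (k : Fin m) :
    ((Equiv.Perm.sign k.cycleRange : ℤ) : ℂ) = (-1) ^ (k : ℕ) := by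
  simp [Fin.sign_cycleRange]

/-- A permutation fixing `0` comes from a permutation of the remaining indices. -/
lemma exists_perm_succ_of_apply_zero {m : ℕ} (τ : Equiv.Perm (Fin (m + 1))) (h : τ 0 = 0) :
    ∃ ρ : Equiv.Perm (Fin m), (∀ i, τ i.succ = (ρ i).succ) ∧
      Equiv.Perm.sign τ = Equiv.Perm.sign ρ := by
  obtain ⟨⟨p, ρ⟩, rfl⟩ := Equiv.Perm.decomposeFin.symm.surjective τ
  have hp : p = 0 := by simpa using h
  subst hp
  exact ⟨ρ, fun i => by simp, by simp [Equiv.Perm.decomposeFin.symm_sign]⟩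

lemma IsSkew.cons {m : ℕ} {w : (Fin (m + 1) → ι) → V} (hw : IsSkew w) (j : ι) :
    IsSkew (fun I : Fin m → ι => w (Fin.cons j I)) := by
  intro σ I
  have h := hw (Equiv.Perm.decomposeFin.symm (0, σ)) (Fin.cons j I)
  rw [Equiv.Perm.decomposeFin.symm_sign] at h
  simp only [if_true, one_mul] at h
  rw [← h]
  refine congrArg w ?_
  funext i
  refine Fin.cases ?_ (fun i => ?_) i <;> simp

lemma IsSkew.eq_zero {m : ℕ} {w : (Fin m → ι) → V} (hw : IsSkew w) {J : Fin m → ι}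
    (hJ : ¬ Function.Injective J) : w J = 0 := by
  simp only [Function.Injective, not_forall] at hJ
  obtain ⟨i, j, hij, hne⟩ := hJ
  have h := hw (Equiv.swap i j) J
  have hJ' : J ∘ Equiv.swap i j = J := by
    funext k
    by_cases hi : k = i
    · subst hi; simp [hij]
    by_cases hj : k = j
    · subst hj; simp [hij]
    · simp [Equiv.swap_apply_of_ne_of_ne hi hj]
  rw [hJ', Equiv.Perm.sign_swap hne] at h
  have h2 : (2 : ℂ) • w J = 0 := by
    rw [two_smul]; nth_rewrite 1 [h]; simp
  exact (smul_eq_zero.mp h2).resolve_left two_ne_zero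

lemma comp_cycleRange_symm {m : ℕ} (K : Fin (m + 1) → ι) (k : Fin (m + 1)) :
    K ∘ k.cycleRange.symm = Fin.cons (K k) (fun i => K (k.succAbove i)) := by
  funext i
  refine Fin.cases ?_ (fun i => ?_) i <;> simp

/-- The alternating sum written with the permutations moving an index to the front. -/
lemma alternatingSum_eq {m : ℕ} (a : ι → (Fin m → ι) → V) (K : Fin (m + 1) → ι) :
    alternatingSum a K = ∑ k : Fin (m + 1), ((Equiv.Perm.sign k.cycleRange : ℤ) : ℂ) •
      a ((K ∘ k.cycleRange.symm) 0) (Fin.tail (K ∘ k.cycleRange.symm)) := by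
  refine Finset.sum_congr rfl fun k _ => ?_
  rw [sign_cycleRange_complex, comp_cycleRange_symm, Fin.cons_zero, Fin.tail_cons]

lemma isSkew_alternatingSum {m : ℕ} {a : ι → (Fin m → ι) → V} (ha : ∀ j, IsSkew (a j)) :
    IsSkew (alternatingSum a) := by
  intro σ K
  rw [alternatingSum_eq, alternatingSum_eq, Finset.smul_sum]
  refine (Finset.sum_congr rfl fun k _ => ?_).trans (Equiv.sum_comp σ _)
  set τ : Equiv.Perm (Fin (m + 1)) := k.cycleRange.symm.trans (σ.trans (σ k).cycleRange) with hτ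
  obtain ⟨ρ, hρ, hs⟩ := exists_perm_succ_of_apply_zero τ (by simp [hτ])
  have hK : (K ∘ σ) ∘ k.cycleRange.symm = (K ∘ (σ k).cycleRange.symm) ∘ τ := by
    funext i; simp [hτ]
  have hs' : Equiv.Perm.sign k.cycleRange * Equiv.Perm.sign ρ
      = Equiv.Perm.sign σ * Equiv.Perm.sign (σ k).cycleRange := by
    rw [← hs, hτ, Equiv.Perm.sign_trans, Equiv.Perm.sign_trans, Equiv.Perm.sign_symm]
    rcases Int.units_eq_one_or (Equiv.Perm.sign k.cycleRange) with h | h <;>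
      simp [h, mul_comm]
  have h0 : ((K ∘ (σ k).cycleRange.symm) ∘ τ) 0 = (K ∘ (σ k).cycleRange.symm) 0 := by
    simp [hτ]
  have ht : Fin.tail ((K ∘ (σ k).cycleRange.symm) ∘ τ)
      = Fin.tail (K ∘ (σ k).cycleRange.symm) ∘ ρ := by
    funext i; simp only [Fin.tail, Function.comp_apply, hρ]
  rw [hK, h0, ht, ha, smul_smul, smul_smul]
  refine congrArg (· • _) ?_
  exact_mod_cast congrArg (fun x : ℤˣ => ((x : ℤ) : ℂ)) hs'

variable [Fintype ι]

lemma sum_comp_perm {M : Type*} [AddCommMonoid M] {m : ℕ} (σ : Equiv.Perm (Fin m))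
    (F : (Fin m → ι) → M) : ∑ J, F (J ∘ σ) = ∑ J, F J :=
  Equiv.sum_comp (Equiv.arrowCongr σ.symm (Equiv.refl ι)) F

lemma sum_fin_succ_pi {M : Type*} [AddCommMonoid M] {m : ℕ} (F : (Fin (m + 1) → ι) → M) :
    ∑ K, F K = ∑ j, ∑ J, F (Fin.cons j J) := by
  rw [← Equiv.sum_comp (Fin.consEquiv fun _ => ι) F, Fintype.sum_prod_type]
  rfl

/-- The Hermitian square of the alternating sum of a family skew in its last indices. -/
lemma sum_alternatingSum {m : ℕ} (B : V →ₗ⋆[ℂ] V →ₗ[ℂ] ℂ) {a : ι → (Fin (m + 1) → ι) → V}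
    (ha : ∀ j, IsSkew (a j)) :
    ∑ K, B (alternatingSum a K) (alternatingSum a K) = (m + 2 : ℂ) *
      (∑ j, ∑ J, B (a j J) (a j J) -
        (m + 1 : ℂ) * ∑ j, ∑ l, ∑ I, B (a l (Fin.cons j I)) (a j (Fin.cons l I))) := by
  have hD := isSkew_alternatingSum ha
  have hfront : ∑ K, B (alternatingSum a K) (alternatingSum a K)
      = (m + 2 : ℂ) * ∑ K : Fin (m + 2) → ι, B (alternatingSum a K) (a (K 0) (Fin.tail K)) := by
    have h1 : ∀ k : Fin (m + 2), ∑ K, B (alternatingSum a K)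
        (((Equiv.Perm.sign k.cycleRange : ℤ) : ℂ) •
          a ((K ∘ k.cycleRange.symm) 0) (Fin.tail (K ∘ k.cycleRange.symm)))
        = ∑ K : Fin (m + 2) → ι, B (alternatingSum a K) (a (K 0) (Fin.tail K)) := by
      intro k
      rw [← sum_comp_perm k.cycleRange]
      refine Finset.sum_congr rfl fun K _ => ?_
      have hK : (K ∘ k.cycleRange) ∘ k.cycleRange.symm = K := by funext i; simp
      rw [hK, hD, LinearMap.map_smulₛₗ₂, map_smul, smul_smul]
      have := sign_mul_self_complex k.cycleRange
      simp only [map_intCast, this, one_smul]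
    calc ∑ K, B (alternatingSum a K) (alternatingSum a K)
        = ∑ K, ∑ k : Fin (m + 2), B (alternatingSum a K)
          (((Equiv.Perm.sign k.cycleRange : ℤ) : ℂ) •
            a ((K ∘ k.cycleRange.symm) 0) (Fin.tail (K ∘ k.cycleRange.symm))) := by
          refine Finset.sum_congr rfl fun K _ => ?_
          rw [← map_sum, ← alternatingSum_eq]
      _ = _ := by
          rw [Finset.sum_comm, Finset.sum_congr rfl fun k _ => h1 k]
          simp
  have hcons : ∀ (j : ι) (J : Fin (m + 1) → ι), alternatingSum a (Fin.cons j J)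
      = a j J - ∑ k : Fin (m + 1), (-1 : ℂ) ^ (k : ℕ) •
        a (J k) (Fin.cons j fun i => J (k.succAbove i)) := by
    intro j J
    rw [alternatingSum, Fin.sum_univ_succ, sub_eq_add_neg, ← Finset.sum_neg_distrib]
    congr 1
    · simp
    · refine Finset.sum_congr rfl fun k _ => ?_
      have : (fun i => (Fin.cons j J : Fin (m + 2) → ι) (k.succ.succAbove i))
          = Fin.cons j fun i => J (k.succAbove i) := by
        funext i
        refine Fin.cases ?_ (fun i => ?_) i <;> simp
      rw [this, Fin.cons_succ, Fin.val_succ, pow_succ, ← neg_smul]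
      simp
  have hoff : ∀ (j : ι) (k : Fin (m + 1)), ∑ J : Fin (m + 1) → ι,
      B ((-1 : ℂ) ^ (k : ℕ) • a (J k) (Fin.cons j fun i => J (k.succAbove i))) (a j J)
      = ∑ l, ∑ I, B (a l (Fin.cons j I)) (a j (Fin.cons l I)) := by
    intro j k
    rw [← sum_comp_perm k.cycleRange, sum_fin_succ_pi]
    refine Finset.sum_congr rfl fun l _ => Finset.sum_congr rfl fun I _ => ?_
    rw [ha, ← sign_cycleRange_complex, LinearMap.map_smulₛₗ₂, map_smul, smul_smul]
    simp only [map_intCast, sign_mul_self_complex, one_smul]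
    simp [Fin.cycleRange_self]
  rw [hfront, sum_fin_succ_pi]
  congr 1
  simp only [Fin.cons_zero, Fin.tail_cons, hcons, map_sub, map_sum, LinearMap.sub_apply,
    LinearMap.sum_apply, Finset.sum_sub_distrib]
  congr 1
  rw [Finset.mul_sum]
  refine Finset.sum_congr rfl fun j _ => ?_
  rw [Finset.sum_comm, Finset.sum_congr rfl fun k _ => hoff j k]
  simp

open Classical in
/-- Summing a symmetric function of tuples vanishing on non-injective tuples. -/
lemma sum_eq_factorial_mul_sum_strictMono {m n : ℕ} (F : (Fin m → Fin n) → ℝ)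
    (hF : ∀ (σ : Equiv.Perm (Fin m)) J, F (J ∘ σ) = F J)
    (hF0 : ∀ J, ¬ Function.Injective J → F J = 0) :
    ∑ J, F J = (m.factorial : ℝ) * ∑ J, if StrictMono J then F J else 0 := by
  have h1 : ∀ J, F J = ∑ σ : Equiv.Perm (Fin m),
      if StrictMono (J ∘ σ) then F (J ∘ σ) else 0 := by
    intro J
    by_cases hJ : Function.Injective J
    · rw [Finset.sum_eq_single (Tuple.sort J)]
      · rw [if_pos ((Tuple.monotone_sort J).strictMono_of_injective
          (hJ.comp (Tuple.sort J).injective)), hF]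
      · intro σ _ hσ
        refine if_neg fun hmono => hσ ?_
        ext i
        exact congrArg _ (hJ (congrFun
          (Tuple.unique_monotone hmono.monotone (Tuple.monotone_sort J)) i))
      · simp
    · rw [hF0 J hJ]
      refine (Finset.sum_eq_zero fun σ _ => ?_).symm
      rw [hF, hF0 J hJ, ite_self]
  rw [Finset.sum_congr rfl fun J _ => h1 J, Finset.sum_comm,
    Finset.sum_congr rfl fun σ _ =>
      sum_comp_perm σ fun J => if StrictMono J then F J else 0]
  simp [Fintype.card_perm]

end SkewFamilies

section SchwartzOperators

open SchwartzMap LineDeriv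
open scoped ContDiff

lemma lineDeriv_slice_fst {n : ℕ} (u : (Fin n → ℂ) × ℝ → ℂ) (z v : Fin n → ℂ) (x : ℝ) :
    lineDeriv ℝ (fun w => u (w, x)) z v = lineDeriv ℝ u (z, x) (v, 0) := by
  simp [lineDeriv]

lemma dX_eq_lineDeriv {n : ℕ} (u : (Fin n → ℂ) × ℝ → ℂ) (p : (Fin n → ℂ) × ℝ) :
    dX u p = lineDeriv ℝ u p (0, 1) := by
  obtain ⟨z, x⟩ := p
  have := deriv_comp_const_add (f := fun s => u (z, s)) x 0
  simpa [dX, lineDeriv] using this.symm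

variable {n : ℕ}

/-- The operator `∂/∂z_j` on Schwartz functions on `ℂⁿ × ℝ`. -/
noncomputable def schwartzDz (j : Fin n) (f : 𝓢((Fin n → ℂ) × ℝ, ℂ)) :
    𝓢((Fin n → ℂ) × ℝ, ℂ) :=
  (1 / 2 : ℂ) • (∂_{((Pi.single j 1 : Fin n → ℂ), (0 : ℝ))} f
    - Complex.I • ∂_{((Pi.single j Complex.I : Fin n → ℂ), (0 : ℝ))} f)

/-- The operator `∂/∂z̄_j` on Schwartz functions on `ℂⁿ × ℝ`. -/
noncomputable def schwartzDzbar (j : Fin n) (f : 𝓢((Fin n → ℂ) × ℝ, ℂ)) :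
    𝓢((Fin n → ℂ) × ℝ, ℂ) :=
  (1 / 2 : ℂ) • (∂_{((Pi.single j 1 : Fin n → ℂ), (0 : ℝ))} f
    + Complex.I • ∂_{((Pi.single j Complex.I : Fin n → ℂ), (0 : ℝ))} f)

/-- The operator `∂/∂x` on Schwartz functions on `ℂⁿ × ℝ`. -/
noncomputable def schwartzDx (f : 𝓢((Fin n → ℂ) × ℝ, ℂ)) : 𝓢((Fin n → ℂ) × ℝ, ℂ) :=
  ∂_{((0 : Fin n → ℂ), (1 : ℝ))} f

/-- Multiplication of Schwartz functions on `ℂⁿ × ℝ` by a function of `z`. -/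
noncomputable def schwartzMul (a : (Fin n → ℂ) → ℂ) (f : 𝓢((Fin n → ℂ) × ℝ, ℂ)) :
    𝓢((Fin n → ℂ) × ℝ, ℂ) :=
  smulLeftCLM ℂ (fun p : (Fin n → ℂ) × ℝ => a p.1) f

/-- Smooth compactly supported functions. -/
def IsTest (a : (Fin n → ℂ) → ℂ) : Prop := ContDiff ℝ ∞ a ∧ HasCompactSupport a

lemma IsTest.hasTemperateGrowth {a : (Fin n → ℂ) → ℂ} (ha : IsTest a) :
    (fun p : (Fin n → ℂ) × ℝ => a p.1).HasTemperateGrowth :=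
  (ha.2.hasTemperateGrowth ha.1).comp
    (ContinuousLinearMap.fst ℝ (Fin n → ℂ) ℝ).hasTemperateGrowth

lemma schwartzMul_apply {a : (Fin n → ℂ) → ℂ} (ha : IsTest a)
    (f : 𝓢((Fin n → ℂ) × ℝ, ℂ)) (p : (Fin n → ℂ) × ℝ) :
    schwartzMul a f p = a p.1 * f p := by
  rw [schwartzMul, smulLeftCLM_apply_apply ha.hasTemperateGrowth, smul_eq_mul]

lemma contDiff_lineDeriv {a : (Fin n → ℂ) → ℂ} (ha : ContDiff ℝ ∞ a) (v : Fin n → ℂ) :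
    ContDiff ℝ ∞ fun z => lineDeriv ℝ a z v := by
  have h : (fun z => lineDeriv ℝ a z v) = fun z => fderiv ℝ a z v := by
    funext z
    exact (ha.differentiable (by simp) z).lineDeriv_eq_fderiv
  rw [h]
  exact (ha.fderiv_right (by simp)).clm_apply contDiff_const

lemma IsTest.lineDeriv {a : (Fin n → ℂ) → ℂ} (ha : IsTest a) (v : Fin n → ℂ) :
    IsTest fun z => lineDeriv ℝ a z v := by
  refine ⟨contDiff_lineDeriv ha.1 v, ?_⟩
  have h : (fun z => _root_.lineDeriv ℝ a z v) = fun z => fderiv ℝ a z v := by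
    funext z
    exact (ha.1.differentiable (by simp) z).lineDeriv_eq_fderiv
  rw [h]
  exact (ha.2.fderiv ℝ).comp_left (g := fun L : (Fin n → ℂ) →L[ℝ] ℂ => L v) rfl

lemma IsTest.wirtZ {a : (Fin n → ℂ) → ℂ} (ha : IsTest a) (j : Fin n) : IsTest (wirtZ a j) :=
  ⟨contDiff_const.mul ((ha.lineDeriv _).1.sub (contDiff_const.mul (ha.lineDeriv _).1)),
    ((ha.lineDeriv _).2.sub (ha.lineDeriv _).2.mul_left).mul_left⟩

lemma IsTest.wirtZbar {a : (Fin n → ℂ) → ℂ} (ha : IsTest a) (j : Fin n) :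
    IsTest (wirtZbar a j) :=
  ⟨contDiff_const.mul ((ha.lineDeriv _).1.add (contDiff_const.mul (ha.lineDeriv _).1)),
    ((ha.lineDeriv _).2.add (ha.lineDeriv _).2.mul_left).mul_left⟩

lemma schwartzDz_apply (j : Fin n) (f : 𝓢((Fin n → ℂ) × ℝ, ℂ)) (p : (Fin n → ℂ) × ℝ) :
    schwartzDz j f p = wirtZ (fun w => f (w, p.2)) j p.1 := by
  simp [schwartzDz, wirtZ, lineDeriv_slice_fst, lineDerivOp_apply]

lemma schwartzDzbar_apply (j : Fin n) (f : 𝓢((Fin n → ℂ) × ℝ, ℂ)) (p : (Fin n → ℂ) × ℝ) :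
    schwartzDzbar j f p = wirtZbar (fun w => f (w, p.2)) j p.1 := by
  simp [schwartzDzbar, wirtZbar, lineDeriv_slice_fst, lineDerivOp_apply, mul_add]

lemma schwartzDx_apply (f : 𝓢((Fin n → ℂ) × ℝ, ℂ)) (p : (Fin n → ℂ) × ℝ) :
    schwartzDx f p = dX f p := by
  rw [dX_eq_lineDeriv, schwartzDx, lineDerivOp_apply]

lemma schwartz_lineDerivOp_comm (v w : (Fin n → ℂ) × ℝ) (f : 𝓢((Fin n → ℂ) × ℝ, ℂ)) :
    ∂_{v} (∂_{w} f) = ∂_{w} (∂_{v} f) := by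
  ext p
  have h : ∀ v w : (Fin n → ℂ) × ℝ,
      (∂_{v} (∂_{w} f) : 𝓢((Fin n → ℂ) × ℝ, ℂ)) p = fderiv ℝ (fderiv ℝ f) p v w := by
    intro v w
    rw [lineDerivOp_apply_eq_fderiv]
    have : (⇑(∂_{w} f : 𝓢((Fin n → ℂ) × ℝ, ℂ)) : (Fin n → ℂ) × ℝ → ℂ)
        = fun q => fderiv ℝ f q w := by
      funext q; exact lineDerivOp_apply_eq_fderiv _ _ _
    rw [this, fderiv_clm_apply]
    · simp
    · exact ((f.smooth 2).fderiv_right (m := 1) (by norm_num)).differentiable (by simp) p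
    · exact differentiableAt_const _
  rw [h, h]
  exact ((f.smooth 2).contDiffAt.isSymmSndFDerivAt (by simp)).eq _ _

lemma lineDeriv_comm {a : (Fin n → ℂ) → ℂ} (ha : ContDiff ℝ ∞ a) (v w z : Fin n → ℂ) :
    lineDeriv ℝ (fun y => lineDeriv ℝ a y w) z v
      = lineDeriv ℝ (fun y => lineDeriv ℝ a y v) z w := by
  have h : ∀ v w, lineDeriv ℝ (fun y => lineDeriv ℝ a y w) z v
      = fderiv ℝ (fderiv ℝ a) z v w := by
    intro v w
    rw [((contDiff_lineDeriv ha w).differentiable (by simp) z).lineDeriv_eq_fderiv]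
    have : (fun y => lineDeriv ℝ a y w) = fun y => fderiv ℝ a y w := by
      funext y
      exact (ha.differentiable (by simp) y).lineDeriv_eq_fderiv
    rw [this, fderiv_clm_apply]
    · simp
    · exact (ha.fderiv_right (m := 1) (by norm_num; exact WithTop.coe_le_coe.2 le_top)).differentiable
        (by simp) z
    · exact differentiableAt_const _
  rw [h, h]
  exact (ha.contDiffAt.isSymmSndFDerivAt (by simp; exact WithTop.coe_le_coe.2 le_top)).eq _ _

/-- The product rule for multiplication by a function of `z`. -/
lemma lineDerivOp_schwartzMul {a : (Fin n → ℂ) → ℂ} (ha : IsTest a) (v : Fin n → ℂ) (s : ℝ)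
    (f : 𝓢((Fin n → ℂ) × ℝ, ℂ)) :
    ∂_{(v, s)} (schwartzMul a f)
      = schwartzMul (fun z => lineDeriv ℝ a z v) f + schwartzMul a (∂_{(v, s)} f) := by
  ext p
  have hd : DifferentiableAt ℝ a p.1 := ha.1.differentiable (by simp) p.1
  have hd' : DifferentiableAt ℝ (fun q : (Fin n → ℂ) × ℝ => a q.1) p :=
    hd.comp p differentiableAt_fst
  have hfun : (⇑(schwartzMul a f) : (Fin n → ℂ) × ℝ → ℂ) = fun q => a q.1 * f q := by
    funext q; exact schwartzMul_apply ha f q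
  have hfst : fderiv ℝ (fun q : (Fin n → ℂ) × ℝ => a q.1) p (v, s) = fderiv ℝ a p.1 v := by
    have := (hd.hasFDerivAt.comp p hasFDerivAt_fst).fderiv
    change fderiv ℝ (a ∘ Prod.fst) p (v, s) = _
    rw [this]; simp
  rw [lineDerivOp_apply_eq_fderiv, hfun, fderiv_fun_mul hd' f.differentiableAt]
  simp only [add_apply, schwartzMul_apply (ha.lineDeriv v), schwartzMul_apply ha,
    lineDerivOp_apply_eq_fderiv, hd.lineDeriv_eq_fderiv, smul_apply, hfst, smul_eq_mul]
  ring

lemma schwartz_lineDerivOp_sub (v : (Fin n → ℂ) × ℝ) (f g : 𝓢((Fin n → ℂ) × ℝ, ℂ)) :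
    ∂_{v} (f - g) = ∂_{v} f - ∂_{v} g := by
  rw [sub_eq_add_neg, sub_eq_add_neg, lineDerivOp_add, lineDerivOp_neg]

lemma schwartzDx_schwartzMul {a : (Fin n → ℂ) → ℂ} (ha : IsTest a)
    (f : 𝓢((Fin n → ℂ) × ℝ, ℂ)) :
    schwartzDx (schwartzMul a f) = schwartzMul a (schwartzDx f) := by
  rw [schwartzDx, lineDerivOp_schwartzMul ha]
  ext p
  rw [add_apply, schwartzMul_apply (ha.lineDeriv 0), lineDeriv_zero, zero_mul, zero_add]
  rfl

lemma schwartzDz_schwartzMul {a : (Fin n → ℂ) → ℂ} (ha : IsTest a) (j : Fin n)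
    (f : 𝓢((Fin n → ℂ) × ℝ, ℂ)) :
    schwartzDz j (schwartzMul a f)
      = schwartzMul (wirtZ a j) f + schwartzMul a (schwartzDz j f) := by
  ext p
  simp only [schwartzDz, lineDerivOp_schwartzMul ha, add_apply, smul_apply, sub_apply,
    schwartzMul_apply ha, schwartzMul_apply (ha.lineDeriv _), schwartzMul_apply (ha.wirtZ j),
    wirtZ, smul_eq_mul]
  ring

lemma schwartzDzbar_schwartzMul {a : (Fin n → ℂ) → ℂ} (ha : IsTest a) (j : Fin n)
    (f : 𝓢((Fin n → ℂ) × ℝ, ℂ)) :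
    schwartzDzbar j (schwartzMul a f)
      = schwartzMul (wirtZbar a j) f + schwartzMul a (schwartzDzbar j f) := by
  ext p
  simp only [schwartzDzbar, lineDerivOp_schwartzMul ha, add_apply, smul_apply,
    schwartzMul_apply ha, schwartzMul_apply (ha.lineDeriv _), schwartzMul_apply (ha.wirtZbar j),
    wirtZbar, smul_eq_mul]
  ring

lemma schwartzDx_schwartzDz (j : Fin n) (f : 𝓢((Fin n → ℂ) × ℝ, ℂ)) :
    schwartzDx (schwartzDz j f) = schwartzDz j (schwartzDx f) := by
  simp only [schwartzDx, schwartzDz, lineDerivOp_smul, schwartz_lineDerivOp_sub,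
    schwartz_lineDerivOp_comm (0, 1)]

lemma schwartzDx_schwartzDzbar (j : Fin n) (f : 𝓢((Fin n → ℂ) × ℝ, ℂ)) :
    schwartzDx (schwartzDzbar j f) = schwartzDzbar j (schwartzDx f) := by
  simp only [schwartzDx, schwartzDzbar, lineDerivOp_smul, lineDerivOp_add,
    schwartz_lineDerivOp_comm (0, 1)]

lemma schwartzDz_schwartzDzbar (j l : Fin n) (f : 𝓢((Fin n → ℂ) × ℝ, ℂ)) :
    schwartzDz j (schwartzDzbar l f) = schwartzDzbar l (schwartzDz j f) := by
  simp only [schwartzDz, schwartzDzbar, lineDerivOp_smul, lineDerivOp_add, schwartz_lineDerivOp_sub,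
    schwartz_lineDerivOp_comm (Pi.single j _, 0)]
  module

lemma lineDeriv_add_of_isTest {a b : (Fin n → ℂ) → ℂ} (ha : IsTest a) (hb : IsTest b)
    (z v : Fin n → ℂ) : lineDeriv ℝ (fun w => a w + b w) z v
      = lineDeriv ℝ a z v + lineDeriv ℝ b z v := by
  have ha' := ha.1.differentiable (by simp) z
  have hb' := hb.1.differentiable (by simp) z
  rw [ha'.lineDeriv_eq_fderiv, hb'.lineDeriv_eq_fderiv, (ha'.fun_add hb').lineDeriv_eq_fderiv,
    fderiv_fun_add ha' hb']
  rfl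

lemma lineDeriv_const_mul_of_isTest {a : (Fin n → ℂ) → ℂ} (ha : IsTest a) (c : ℂ)
    (z v : Fin n → ℂ) : lineDeriv ℝ (fun w => c * a w) z v = c * lineDeriv ℝ a z v := by
  have ha' := ha.1.differentiable (by simp) z
  rw [ha'.lineDeriv_eq_fderiv, (ha'.const_mul c).lineDeriv_eq_fderiv, fderiv_const_mul ha']
  rfl

lemma IsTest.const_mul {a : (Fin n → ℂ) → ℂ} (ha : IsTest a) (c : ℂ) :
    IsTest fun z => c * a z :=
  ⟨contDiff_const.mul ha.1, ha.2.mul_left⟩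

lemma wirtZbar_wirtZ {a : (Fin n → ℂ) → ℂ} (ha : IsTest a) (j l : Fin n) (z : Fin n → ℂ) :
    wirtZbar (wirtZ a j) l z = wirtZ (wirtZbar a l) j z := by
  have hZ : wirtZ a j = fun w => (1 / 2 : ℂ) * lineDeriv ℝ a w (Pi.single j 1)
      + (-(1 / 2) * Complex.I) * lineDeriv ℝ a w (Pi.single j Complex.I) := by
    funext w; rw [wirtZ]; ring
  have hZb : wirtZbar a l = fun w => (1 / 2 : ℂ) * lineDeriv ℝ a w (Pi.single l 1)
      + (1 / 2 * Complex.I) * lineDeriv ℝ a w (Pi.single l Complex.I) := by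
    funext w; rw [wirtZbar]; ring
  rw [hZ, hZb, wirtZbar, wirtZ]
  simp only [lineDeriv_add_of_isTest ((ha.lineDeriv _).const_mul _)
    ((ha.lineDeriv _).const_mul _), lineDeriv_const_mul_of_isTest (ha.lineDeriv _),
    lineDeriv_comm ha.1 (Pi.single l _)]
  ring

/-- The vector field `Z_j` on Schwartz functions. -/
noncomputable def schwartzZ (ψ : (Fin n → ℂ) → ℝ) (j : Fin n) (f : 𝓢((Fin n → ℂ) × ℝ, ℂ)) :
    𝓢((Fin n → ℂ) × ℝ, ℂ) :=
  schwartzDz j f + Complex.I • schwartzMul (wirtZR ψ j) (schwartzDx f)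

/-- The vector field `Z̄_j` on Schwartz functions. -/
noncomputable def schwartzZbar (ψ : (Fin n → ℂ) → ℝ) (j : Fin n)
    (f : 𝓢((Fin n → ℂ) × ℝ, ℂ)) : 𝓢((Fin n → ℂ) × ℝ, ℂ) :=
  schwartzDzbar j f - Complex.I • schwartzMul (wirtZbarR ψ j) (schwartzDx f)

variable {ψ : (Fin n → ℂ) → ℝ}

lemma schwartzZ_apply (hψ : IsTest fun z => (ψ z : ℂ)) (j : Fin n)
    (f : 𝓢((Fin n → ℂ) × ℝ, ℂ)) (p : (Fin n → ℂ) × ℝ) :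
    schwartzZ ψ j f p = Zorig ψ j f p := by
  have h : IsTest (wirtZR ψ j) := hψ.wirtZ j
  simp [schwartzZ, Zorig, schwartzDz_apply, schwartzDx_apply, schwartzMul_apply h, mul_assoc]

lemma schwartzZbar_apply (hψ : IsTest fun z => (ψ z : ℂ)) (j : Fin n)
    (f : 𝓢((Fin n → ℂ) × ℝ, ℂ)) (p : (Fin n → ℂ) × ℝ) :
    schwartzZbar ψ j f p = Zbar ψ j f p := by
  have h : IsTest (wirtZbarR ψ j) := hψ.wirtZbar j
  simp [schwartzZbar, Zbar, schwartzDzbar_apply, schwartzDx_apply, schwartzMul_apply h,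
    mul_assoc]

/-- The commutator of `Z_j` and `Z̄_l` is `-2i (∂²φ/∂z_j∂z̄_l) ∂/∂x`. -/
lemma schwartzZ_schwartzZbar_sub (hψ : IsTest fun z => (ψ z : ℂ)) (j l : Fin n)
    (f : 𝓢((Fin n → ℂ) × ℝ, ℂ)) :
    schwartzZ ψ j (schwartzZbar ψ l f) - schwartzZbar ψ l (schwartzZ ψ j f)
      = (-2 * Complex.I) • schwartzMul (leviForm ψ j l) (schwartzDx f) := by
  have hj : IsTest (wirtZR ψ j) := hψ.wirtZ j
  have hl : IsTest (wirtZbarR ψ l) := hψ.wirtZbar l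
  have hjl : IsTest (leviForm ψ j l) := hl.wirtZ j
  have hlevi : wirtZ (wirtZbarR ψ l) j = leviForm ψ j l := rfl
  have hsymm : wirtZbar (wirtZR ψ j) l = leviForm ψ j l := by
    funext z; exact wirtZbar_wirtZ hψ j l z
  have hDz : ∀ (f g : 𝓢((Fin n → ℂ) × ℝ, ℂ)) (c : ℂ),
      schwartzDz j (f - c • g) = schwartzDz j f - c • schwartzDz j g := by
    intro f g c
    simp only [schwartzDz, schwartz_lineDerivOp_sub, lineDerivOp_smul]
    module
  have hDzb : ∀ (f g : 𝓢((Fin n → ℂ) × ℝ, ℂ)) (c : ℂ),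
      schwartzDzbar l (f + c • g) = schwartzDzbar l f + c • schwartzDzbar l g := by
    intro f g c
    simp only [schwartzDzbar, lineDerivOp_add, lineDerivOp_smul]
    module
  have hDx : ∀ (f g : 𝓢((Fin n → ℂ) × ℝ, ℂ)) (c : ℂ),
      schwartzDx (f + c • g) = schwartzDx f + c • schwartzDx g := by
    intro f g c
    simp only [schwartzDx, lineDerivOp_add, lineDerivOp_smul]
  have hDx' : ∀ (f g : 𝓢((Fin n → ℂ) × ℝ, ℂ)) (c : ℂ),
      schwartzDx (f - c • g) = schwartzDx f - c • schwartzDx g := by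
    intro f g c
    simp only [schwartzDx, schwartz_lineDerivOp_sub, lineDerivOp_smul]
  simp only [schwartzZ, schwartzZbar, hDz, hDzb, hDx, hDx', schwartzDz_schwartzMul hl,
    schwartzDzbar_schwartzMul hj, schwartzDx_schwartzMul hl, schwartzDx_schwartzMul hj, hsymm,
    hlevi, schwartzDx_schwartzDz, schwartzDx_schwartzDzbar, schwartzDz_schwartzDzbar]
  ext p
  simp only [add_apply, sub_apply, smul_apply, schwartzMul_apply hj, schwartzMul_apply hl,
    schwartzMul_apply hjl, smul_eq_mul]
  ring


section IntegralForm

variable {D : Type*} [NormedAddCommGroup D] [NormedSpace ℝ D] [FiniteDimensional ℝ D]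
  [MeasurableSpace D] [BorelSpace D] (μ : Measure D)

/-- The real bilinear map `(a, b) ↦ conj a * b` on `ℂ`. -/
noncomputable def conjMulL : ℂ →L[ℝ] ℂ →L[ℝ] ℂ :=
  (ContinuousLinearMap.mul ℝ ℂ).comp Complex.conjCLE.toContinuousLinearMap

lemma integrable_conj_mul [μ.HasTemperateGrowth] (g f : 𝓢(D, ℂ)) :
    Integrable (fun p => (starRingEnd ℂ) (g p) * f p) μ :=
  (pairing conjMulL g f).integrable

lemma integral_conj_mul_lineDerivOp [μ.IsAddHaarMeasure] (g f : 𝓢(D, ℂ)) (v : D) :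
    ∫ p, (starRingEnd ℂ) (g p) * (∂_{v} f : 𝓢(D, ℂ)) p ∂μ
      = -∫ p, (starRingEnd ℂ) ((∂_{v} g : 𝓢(D, ℂ)) p) * f p ∂μ :=
  integral_bilinear_lineDerivOp_right_eq_neg_left g f conjMulL v

end IntegralForm

instance isAddHaarMeasure_volume_prod_real (n : ℕ) :
    (volume : Measure ((Fin n → ℂ) × ℝ)).IsAddHaarMeasure :=
  Measure.prod.instIsAddHaarMeasure (volume : Measure (Fin n → ℂ)) (volume : Measure ℝ)

/-- The `L²` inner product of Schwartz functions on `ℂⁿ × ℝ`. -/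
noncomputable def schwartzForm (n : ℕ) :
    𝓢((Fin n → ℂ) × ℝ, ℂ) →ₗ⋆[ℂ] 𝓢((Fin n → ℂ) × ℝ, ℂ) →ₗ[ℂ] ℂ :=
  LinearMap.mk₂'ₛₗ (starRingEnd ℂ) (RingHom.id ℂ)
    (fun g f => ∫ p, (starRingEnd ℂ) (g p) * f p)
    (fun g₁ g₂ f => by
      rw [← integral_add (integrable_conj_mul _ _ _) (integrable_conj_mul _ _ _)]
      simp [add_mul])
    (fun c g f => by
      rw [smul_eq_mul, ← integral_const_mul]
      simp [mul_assoc])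
    (fun g f₁ f₂ => by
      rw [← integral_add (integrable_conj_mul _ _ _) (integrable_conj_mul _ _ _)]
      simp [mul_add])
    (fun c g f => by
      rw [smul_eq_mul, ← integral_const_mul]
      simp [mul_left_comm])

lemma schwartzForm_apply (g f : 𝓢((Fin n → ℂ) × ℝ, ℂ)) :
    schwartzForm n g f = ∫ p, (starRingEnd ℂ) (g p) * f p := rfl

lemma schwartzForm_self (f : 𝓢((Fin n → ℂ) × ℝ, ℂ)) :
    schwartzForm n f f = ((∫ p, ‖f p‖ ^ 2 : ℝ) : ℂ) := by
  rw [schwartzForm_apply, ← integral_complex_ofReal]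
  simp [Complex.conj_mul']

lemma schwartzForm_conj (g f : 𝓢((Fin n → ℂ) × ℝ, ℂ)) :
    (starRingEnd ℂ) (schwartzForm n g f) = schwartzForm n f g := by
  rw [schwartzForm_apply, schwartzForm_apply, ← integral_conj]
  simp [mul_comm]

lemma schwartzForm_lineDerivOp (g f : 𝓢((Fin n → ℂ) × ℝ, ℂ)) (v : (Fin n → ℂ) × ℝ) :
    schwartzForm n g (∂_{v} f) = -schwartzForm n (∂_{v} g) f :=
  integral_conj_mul_lineDerivOp _ g f v

lemma schwartzForm_schwartzMul {a b : (Fin n → ℂ) → ℂ} (ha : IsTest a) (hb : IsTest b)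
    (hab : ∀ z, (starRingEnd ℂ) (a z) = b z) (g f : 𝓢((Fin n → ℂ) × ℝ, ℂ)) :
    schwartzForm n g (schwartzMul a f) = schwartzForm n (schwartzMul b g) f := by
  rw [schwartzForm_apply, schwartzForm_apply]
  congr 1
  funext p
  rw [schwartzMul_apply ha, schwartzMul_apply hb, ← hab, map_mul, Complex.conj_conj]
  ring

lemma conj_lineDeriv_ofReal (hψ : IsTest fun z => (ψ z : ℂ)) (z v : Fin n → ℂ) :
    (starRingEnd ℂ) (lineDeriv ℝ (fun w => (ψ w : ℂ)) z v)
      = lineDeriv ℝ (fun w => (ψ w : ℂ)) z v := by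
  have h := (hψ.1.differentiable (by simp) z).hasFDerivAt.hasLineDerivAt v
  have h' := (Complex.conjCLE.hasFDerivAt.comp_hasDerivAt (0 : ℝ) h)
  have h2 : HasLineDerivAt ℝ (fun w => (ψ w : ℂ))
      ((starRingEnd ℂ) (fderiv ℝ (fun w => (ψ w : ℂ)) z v)) z v := by
    simpa [HasLineDerivAt, Function.comp_def] using h'
  rw [h.lineDeriv, ← h2.lineDeriv, h.lineDeriv]

lemma conj_wirtZR (hψ : IsTest fun z => (ψ z : ℂ)) (j : Fin n) (z : Fin n → ℂ) :
    (starRingEnd ℂ) (wirtZR ψ j z) = wirtZbarR ψ j z := by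
  simp [wirtZR, wirtZbarR, wirtZ, wirtZbar, conj_lineDeriv_ofReal hψ, Complex.conj_ofNat]

lemma schwartzForm_schwartzDz (j : Fin n) (g f : 𝓢((Fin n → ℂ) × ℝ, ℂ)) :
    schwartzForm n g (schwartzDz j f) = -schwartzForm n (schwartzDzbar j g) f := by
  simp only [schwartzDz, schwartzDzbar, map_smul, map_sub, map_add, schwartzForm_lineDerivOp,
    LinearMap.map_smulₛₗ, LinearMap.smul_apply, LinearMap.add_apply, smul_eq_mul, Complex.conj_I]
  simp only [map_div₀, map_one, Complex.conj_ofNat]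
  ring

lemma schwartzForm_schwartzZ (hψ : IsTest fun z => (ψ z : ℂ)) (j : Fin n)
    (g f : 𝓢((Fin n → ℂ) × ℝ, ℂ)) :
    schwartzForm n g (schwartzZ ψ j f) = -schwartzForm n (schwartzZbar ψ j g) f := by
  have h : IsTest (wirtZR ψ j) := hψ.wirtZ j
  have h' : IsTest (wirtZbarR ψ j) := hψ.wirtZbar j
  have hx : schwartzForm n g (schwartzMul (wirtZR ψ j) (schwartzDx f))
      = -schwartzForm n (schwartzMul (wirtZbarR ψ j) (schwartzDx g)) f := by
    rw [schwartzForm_schwartzMul h h' (conj_wirtZR hψ j), schwartzDx, schwartzForm_lineDerivOp,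
      ← schwartzDx, schwartzDx_schwartzMul h']
  rw [schwartzZ, schwartzZbar, map_add, schwartzForm_schwartzDz, map_smul, hx]
  simp only [map_sub, LinearMap.map_smulₛₗ, LinearMap.sub_apply, LinearMap.smul_apply,
    smul_eq_mul, Complex.conj_I]
  ring

lemma schwartzForm_schwartzZbar (hψ : IsTest fun z => (ψ z : ℂ)) (j : Fin n)
    (g f : 𝓢((Fin n → ℂ) × ℝ, ℂ)) :
    schwartzForm n g (schwartzZbar ψ j f) = -schwartzForm n (schwartzZ ψ j g) f := by
  rw [← schwartzForm_conj, ← neg_eq_iff_eq_neg.2 (schwartzForm_schwartzZ hψ j f g), map_neg,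
    schwartzForm_conj]

section RealLine

open scoped FourierTransform

lemma fourier_lineDerivOp_one_apply (f : 𝓢(ℝ, ℂ)) (ξ : ℝ) :
    (𝓕 (∂_{(1 : ℝ)} f) : 𝓢(ℝ, ℂ)) ξ = 2 * Real.pi * Complex.I * ξ * (𝓕 f : 𝓢(ℝ, ℂ)) ξ := by
  have h : (inner ℝ · (1 : ℝ) : ℝ → ℝ).HasTemperateGrowth := by fun_prop
  rw [fourier_lineDerivOp_eq, smul_apply, smulLeftCLM_apply_apply h]
  simp [mul_assoc]

lemma integral_conj_mul_fourier (f g : 𝓢(ℝ, ℂ)) :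
    ∫ ξ, (starRingEnd ℂ) ((𝓕 g : 𝓢(ℝ, ℂ)) ξ) * (𝓕 f : 𝓢(ℝ, ℂ)) ξ
      = ∫ x, (starRingEnd ℂ) (g x) * f x := by
  simpa [RCLike.inner_apply, mul_comm] using integral_inner_fourier_fourier g f

lemma fourier_eq_zero_of_lt {f : 𝓢(ℝ, ℂ)} {t₀ : ℝ}
    (hf : ∀ t < t₀, ∫ x : ℝ, Complex.exp (-(Complex.I * t * x)) * f x = 0) {ξ : ℝ}
    (hξ : 2 * Real.pi * ξ < t₀) : (𝓕 f : 𝓢(ℝ, ℂ)) ξ = 0 := by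
  rw [fourier_coe, Real.fourier_eq', ← hf _ hξ]
  congr 1
  funext x
  simp only [smul_eq_mul, RCLike.inner_apply, conj_trivial]
  congr 2
  push_cast
  ring

/-- The lower bound for the first-order operator `-2i Σ A_jl ∂/∂x` on functions with spectrum
in `[t₀, ∞)`. -/
lemma le_re_sum_integral_of_spectrum {A : Fin n → Fin n → ℂ} {ε t₀ : ℝ} (hε : 0 ≤ ε)
    (ht₀ : 0 ≤ t₀)
    (hA : ∀ ξ : Fin n → ℂ, ε * ∑ j, ‖ξ j‖ ^ 2 ≤
      (∑ j, ∑ l, A j l * ξ j * (starRingEnd ℂ) (ξ l)).re)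
    (h : Fin n → 𝓢(ℝ, ℂ))
    (hh : ∀ j, ∀ t < t₀, ∫ x : ℝ, Complex.exp (-(Complex.I * t * x)) * h j x = 0) :
    2 * t₀ * ε * ∑ j, ∫ x, ‖h j x‖ ^ 2 ≤
      (∑ j, ∑ l, -2 * Complex.I * A j l *
        ∫ x, (starRingEnd ℂ) (h l x) * (∂_{(1 : ℝ)} (h j) : 𝓢(ℝ, ℂ)) x).re := by
  have hint : ∀ j l, Integrable fun ξ => -2 * Complex.I * A j l *
      ((starRingEnd ℂ) ((𝓕 (h l) : 𝓢(ℝ, ℂ)) ξ) *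
        (𝓕 (∂_{(1 : ℝ)} (h j)) : 𝓢(ℝ, ℂ)) ξ) := fun j l =>
    (integrable_conj_mul volume _ _).const_mul _
  have hsq : ∀ j, Integrable fun ξ => ‖(𝓕 (h j) : 𝓢(ℝ, ℂ)) ξ‖ ^ 2 := fun j =>
    ((𝓕 (h j) : 𝓢(ℝ, ℂ)).memLp 2 volume).integrable_norm_pow (by norm_num)
  simp_rw [← integral_norm_sq_fourier (h _), ← integral_conj_mul_fourier (∂_{(1 : ℝ)} (h _)),
    ← integral_const_mul]
  rw [← integral_finsetSum _ fun j _ => hsq j, ← integral_const_mul]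
  simp_rw [← integral_finsetSum _ fun l _ => hint _ l]
  rw [← integral_finsetSum _ fun j _ => integrable_finsetSum _ fun l _ => hint j l]
  have hint' := integrable_finsetSum Finset.univ fun j _ =>
    integrable_finsetSum Finset.univ fun l _ => hint j l
  rw [← Complex.reCLM_apply, ← Complex.reCLM.integral_comp_comm hint']
  refine integral_mono ((integrable_finsetSum _ fun j _ => hsq j).const_mul _)
    (Complex.reCLM.integrable_comp hint') fun ξ => ?_
  have hsum : ∑ j, ∑ l, -2 * Complex.I * A j l * ((starRingEnd ℂ) ((𝓕 (h l) : 𝓢(ℝ, ℂ)) ξ) *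
      (𝓕 (∂_{(1 : ℝ)} (h j)) : 𝓢(ℝ, ℂ)) ξ)
      = ((2 * (2 * Real.pi * ξ) : ℝ) : ℂ) * ∑ j, ∑ l, A j l * (𝓕 (h j) : 𝓢(ℝ, ℂ)) ξ *
        (starRingEnd ℂ) ((𝓕 (h l) : 𝓢(ℝ, ℂ)) ξ) := by
    simp only [Finset.mul_sum]
    refine Finset.sum_congr rfl fun j _ => Finset.sum_congr rfl fun l _ => ?_
    rw [fourier_lineDerivOp_one_apply]
    push_cast
    linear_combination (-4 * Real.pi * ξ * A j l * (𝓕 (h j) : 𝓢(ℝ, ℂ)) ξ *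
      (starRingEnd ℂ) ((𝓕 (h l) : 𝓢(ℝ, ℂ)) ξ)) * Complex.I_sq
  simp only [Complex.reCLM_apply, hsum, Complex.re_ofReal_mul]
  rcases lt_or_ge (2 * Real.pi * ξ) t₀ with hξ | hξ
  · simp [fourier_eq_zero_of_lt (hh _) hξ]
  · have h0 : 0 ≤ ε * ∑ j, ‖(𝓕 (h j) : 𝓢(ℝ, ℂ)) ξ‖ ^ 2 := by positivity
    have hξ0 : 0 ≤ 2 * (2 * Real.pi * ξ) := by linarith
    calc 2 * t₀ * ε * ∑ j, ‖(𝓕 (h j) : 𝓢(ℝ, ℂ)) ξ‖ ^ 2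
        = 2 * t₀ * (ε * ∑ j, ‖(𝓕 (h j) : 𝓢(ℝ, ℂ)) ξ‖ ^ 2) := by ring
      _ ≤ 2 * (2 * Real.pi * ξ) * _ := by gcongr; exact hA fun j => (𝓕 (h j) : 𝓢(ℝ, ℂ)) ξ

end RealLine

/-- The restriction of a Schwartz function on `ℂⁿ × ℝ` to the line `{z} × ℝ`. -/
noncomputable def schwartzSlice (z : Fin n → ℂ) (f : 𝓢((Fin n → ℂ) × ℝ, ℂ)) : 𝓢(ℝ, ℂ) :=
  compCLMOfAntilipschitz (K := 1) ℂ (g := fun x : ℝ => (z, x))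
    (by
      have h : (fun x : ℝ => (z, x)) = fun x =>
          ((z, 0) : (Fin n → ℂ) × ℝ) + ContinuousLinearMap.inr ℝ (Fin n → ℂ) ℝ x := by
        funext x; simp
      rw [h]
      exact (Function.HasTemperateGrowth.const _).add
        (ContinuousLinearMap.inr ℝ (Fin n → ℂ) ℝ).hasTemperateGrowth)
    (AntilipschitzWith.of_le_mul_dist fun x y => by simp [Prod.dist_eq]) f

lemma schwartzSlice_apply (z : Fin n → ℂ) (f : 𝓢((Fin n → ℂ) × ℝ, ℂ)) (x : ℝ) :
    schwartzSlice z f x = f (z, x) := rfl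

lemma lineDerivOp_schwartzSlice (z : Fin n → ℂ) (f : 𝓢((Fin n → ℂ) × ℝ, ℂ)) (x : ℝ) :
    (∂_{(1 : ℝ)} (schwartzSlice z f) : 𝓢(ℝ, ℂ)) x = schwartzDx f (z, x) := by
  rw [schwartzDx, lineDerivOp_apply, lineDerivOp_apply]
  simp [lineDeriv, schwartzSlice_apply]

/-- The lower bound for the commutator term on forms with spectrum in `[t₀, ∞)`. -/
lemma le_re_sum_schwartzForm_of_spectrum (hψ : IsTest fun z => (ψ z : ℂ)) {ε t₀ : ℝ}
    (hε : 0 ≤ ε) (ht₀ : 0 ≤ t₀) {K : Set (Fin n → ℂ)}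
    (hLevi : ∀ z ∈ K, ∀ ξ : Fin n → ℂ, ε * ∑ j, ‖ξ j‖ ^ 2 ≤
      (∑ j, ∑ l, leviForm ψ j l z * ξ j * (starRingEnd ℂ) (ξ l)).re)
    (w : Fin n → 𝓢((Fin n → ℂ) × ℝ, ℂ)) (hw : ∀ j, ∀ z ∉ K, ∀ x, w j (z, x) = 0)
    (hspec : ∀ j z, ∀ t < t₀, pft (w j) z t = 0) :
    2 * t₀ * ε * ∑ j, ∫ p, ‖w j p‖ ^ 2 ≤
      (∑ j, ∑ l, schwartzForm n (w l)
        ((-2 * Complex.I) • schwartzMul (leviForm ψ j l) (schwartzDx (w j)))).re := by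
  have hlevi : ∀ j l, IsTest (leviForm ψ j l) := fun j l => (hψ.wirtZbar l).wirtZ j
  have hint : ∀ j l, Integrable (fun p : (Fin n → ℂ) × ℝ => (starRingEnd ℂ) (w l p) *
      ((-2 * Complex.I) • schwartzMul (leviForm ψ j l) (schwartzDx (w j))) p)
      (volume.prod volume) := fun j l => integrable_conj_mul volume _ _
  have hsq : ∀ j, Integrable (fun p => ‖w j p‖ ^ 2) (volume.prod volume) := fun j =>
    ((w j).memLp 2 volume).integrable_norm_pow (by norm_num)
  have hinner : ∀ j l z, ∫ x, (starRingEnd ℂ) (w l (z, x)) *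
      ((-2 * Complex.I) • schwartzMul (leviForm ψ j l) (schwartzDx (w j))) (z, x)
      = -2 * Complex.I * leviForm ψ j l z * ∫ x, (starRingEnd ℂ) (schwartzSlice z (w l) x) *
        (∂_{(1 : ℝ)} (schwartzSlice z (w j)) : 𝓢(ℝ, ℂ)) x := by
    intro j l z
    rw [← integral_const_mul]
    congr 1
    funext x
    rw [lineDerivOp_schwartzSlice, schwartzSlice_apply, smul_apply, schwartzMul_apply (hlevi j l),
      smul_eq_mul]
    ring
  simp only [schwartzForm_apply, Measure.volume_eq_prod]
  simp_rw [integral_prod _ (hint _ _), integral_prod _ (hsq _)]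
  have hsq' := fun j => (hsq j).integral_prod_left
  have hint' := fun j l => (hint j l).integral_prod_left
  have hint2 := integrable_finsetSum Finset.univ fun j _ =>
    integrable_finsetSum Finset.univ fun l _ => hint' j l
  rw [← integral_finsetSum _ fun j _ => hsq' j, ← integral_const_mul]
  simp_rw [← integral_finsetSum _ fun l _ => hint' _ l]
  rw [← integral_finsetSum _ fun j _ => integrable_finsetSum _ fun l _ => hint' j l,
    ← Complex.reCLM_apply, ← Complex.reCLM.integral_comp_comm hint2]
  refine integral_mono ((integrable_finsetSum _ fun j _ => hsq' j).const_mul _)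
    (Complex.reCLM.integrable_comp hint2) fun z => ?_
  simp only [hinner, Complex.reCLM_apply]
  by_cases hz : z ∈ K
  · exact le_re_sum_integral_of_spectrum hε ht₀ (hLevi z hz) (fun j => schwartzSlice z (w j))
      fun j t ht => hspec j z t ht
  · simp [schwartzSlice_apply, hw _ z hz]

section Cutoff

open Filter Topology

lemma exists_isTest_eventuallyEq {φ : (Fin n → ℂ) → ℝ} (hφ : ContDiff ℝ ∞ φ)
    {K : Set (Fin n → ℂ)} (hK : IsCompact K) :
    ∃ ψ : (Fin n → ℂ) → ℝ, IsTest (fun z => (ψ z : ℂ)) ∧ ∀ z ∈ K, ψ =ᶠ[𝓝 z] φ := by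
  obtain ⟨R, hR, hKR⟩ := hK.isBounded.subset_ball_lt 0 0
  let χ : ContDiffBump (0 : Fin n → ℂ) := ⟨R, R + 1, hR, lt_add_one R⟩
  refine ⟨fun z => χ z * φ z,
    ⟨Complex.ofRealCLM.contDiff.comp (χ.contDiff.mul hφ),
      χ.hasCompactSupport.mul_right.comp_left Complex.ofReal_zero⟩, fun z hz => ?_⟩
  filter_upwards [χ.eventuallyEq_one_of_mem_ball (hKR hz)] with w hw
  simp [hw]

variable {φ : (Fin n → ℂ) → ℝ} {z : Fin n → ℂ}

lemma wirtZR_congr (h : ψ =ᶠ[𝓝 z] φ) (j : Fin n) : wirtZR ψ j z = wirtZR φ j z := by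
  have h' : (fun w => (ψ w : ℂ)) =ᶠ[𝓝 z] fun w => (φ w : ℂ) := h.fun_comp Complex.ofReal
  rw [wirtZR, wirtZR, wirtZ, wirtZ, h'.lineDeriv_eq, h'.lineDeriv_eq]

lemma wirtZbarR_congr (h : ψ =ᶠ[𝓝 z] φ) (j : Fin n) : wirtZbarR ψ j z = wirtZbarR φ j z := by
  have h' : (fun w => (ψ w : ℂ)) =ᶠ[𝓝 z] fun w => (φ w : ℂ) := h.fun_comp Complex.ofReal
  rw [wirtZbarR, wirtZbarR, wirtZbar, wirtZbar, h'.lineDeriv_eq, h'.lineDeriv_eq]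

lemma leviForm_congr (h : ψ =ᶠ[𝓝 z] φ) (j k : Fin n) : leviForm ψ j k z = leviForm φ j k z := by
  have h' : (fun w => wirtZbarR ψ k w) =ᶠ[𝓝 z] fun w => wirtZbarR φ k w :=
    h.eventually_nhds.mono fun w hw => wirtZbarR_congr hw k
  rw [leviForm, leviForm, wirtZ, wirtZ, h'.lineDeriv_eq, h'.lineDeriv_eq]

variable {K : Set (Fin n → ℂ)} {f : (Fin n → ℂ) × ℝ → ℂ}

lemma dX_eq_zero_of_notMem (hf : ∀ z ∉ K, ∀ x, f (z, x) = 0) {p : (Fin n → ℂ) × ℝ}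
    (hp : p.1 ∉ K) : dX f p = 0 := by
  simp [dX, hf _ hp]

lemma Zorig_congr (h : ∀ z ∈ K, ψ =ᶠ[𝓝 z] φ) (hf : ∀ z ∉ K, ∀ x, f (z, x) = 0) (j : Fin n) :
    Zorig ψ j f = Zorig φ j f := by
  funext p
  by_cases hp : p.1 ∈ K
  · rw [Zorig, Zorig, wirtZR_congr (h _ hp)]
  · rw [Zorig, Zorig, dX_eq_zero_of_notMem hf hp, mul_zero, mul_zero]

lemma Zbar_congr (h : ∀ z ∈ K, ψ =ᶠ[𝓝 z] φ) (hf : ∀ z ∉ K, ∀ x, f (z, x) = 0) (j : Fin n) :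
    Zbar ψ j f = Zbar φ j f := by
  funext p
  by_cases hp : p.1 ∈ K
  · rw [Zbar, Zbar, wirtZbarR_congr (h _ hp)]
  · rw [Zbar, Zbar, dX_eq_zero_of_notMem hf hp, mul_zero, mul_zero]

end Cutoff

section Forms

lemma schwartzZ_smul (j : Fin n) (c : ℂ) (f : 𝓢((Fin n → ℂ) × ℝ, ℂ)) :
    schwartzZ ψ j (c • f) = c • schwartzZ ψ j f := by
  simp only [schwartzZ, schwartzDz, schwartzDx, schwartzMul, lineDerivOp_smul, map_smul]
  module

lemma schwartzZbar_smul (j : Fin n) (c : ℂ) (f : 𝓢((Fin n → ℂ) × ℝ, ℂ)) :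
    schwartzZbar ψ j (c • f) = c • schwartzZbar ψ j f := by
  simp only [schwartzZbar, schwartzDzbar, schwartzDx, schwartzMul, lineDerivOp_smul, map_smul]
  module

lemma factorial_mul_formNormSq {m : ℕ} {W : (Fin m → Fin n) → 𝓢((Fin n → ℂ) × ℝ, ℂ)}
    (hW : IsSkew W) :
    (m.factorial : ℝ) * formNormSq (fun J => ⇑(W J)) = ∑ J, ∫ p, ‖W J p‖ ^ 2 := by
  rw [formNormSq, sum_eq_factorial_mul_sum_strictMono (fun J => ∫ p, ‖W J p‖ ^ 2)]
  · intro σ J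
    rcases Int.units_eq_one_or (Equiv.Perm.sign σ) with h | h <;> simp [hW σ J, h]
  · intro J hJ
    simp [hW.eq_zero hJ]

lemma ofReal_factorial_mul_formNormSq {m : ℕ} {W : (Fin m → Fin n) → 𝓢((Fin n → ℂ) × ℝ, ℂ)}
    (hW : IsSkew W) :
    (((m.factorial : ℝ) * formNormSq (fun J => ⇑(W J)) : ℝ) : ℂ)
      = ∑ J, schwartzForm n (W J) (W J) := by
  rw [factorial_mul_formNormSq hW]
  simp [schwartzForm_self]

lemma isSkew_schwartzZbar {m : ℕ} {U : (Fin m → Fin n) → 𝓢((Fin n → ℂ) × ℝ, ℂ)}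
    (hU : IsSkew U) (j : Fin n) : IsSkew fun J => schwartzZbar ψ j (U J) := fun σ J => by
  simp only [hU σ J, schwartzZbar_smul]

lemma isSkew_sum_schwartzZ {m : ℕ} {U : (Fin (m + 1) → Fin n) → 𝓢((Fin n → ℂ) × ℝ, ℂ)}
    (hU : IsSkew U) : IsSkew fun I : Fin m → Fin n => -∑ j, schwartzZ ψ j (U (Fin.cons j I)) :=
  fun σ I => by
    simp only [hU.cons _ σ I, schwartzZ_smul, ← Finset.smul_sum, smul_neg]

/-- The Bochner-Kodaira-Morrey-Kohn formula. -/
lemma factorial_mul_formNormSq_add {m : ℕ} (hψ : IsTest fun z => (ψ z : ℂ))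
    {U : (Fin (m + 1) → Fin n) → 𝓢((Fin n → ℂ) × ℝ, ℂ)} (hU : IsSkew U) :
    (m.factorial : ℝ) *
        (formNormSq (fun K => ⇑(alternatingSum (fun j J => schwartzZbar ψ j (U J)) K)) +
          formNormSq (fun I => ⇑(-∑ j, schwartzZ ψ j (U (Fin.cons j I))))) =
      (∑ j, ∑ J, ∫ p, ‖schwartzZbar ψ j (U J) p‖ ^ 2) / (m + 1) +
        ∑ I, (∑ j, ∑ l, schwartzForm n (U (Fin.cons l I))
          ((-2 * Complex.I) • schwartzMul (leviForm ψ j l)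
            (schwartzDx (U (Fin.cons j I))))).re := by
  have hD := ofReal_factorial_mul_formNormSq
    (isSkew_alternatingSum fun j => isSkew_schwartzZbar (ψ := ψ) hU j)
  rw [sum_alternatingSum _ fun j => isSkew_schwartzZbar hU j] at hD
  have hA := ofReal_factorial_mul_formNormSq (isSkew_sum_schwartzZ (ψ := ψ) hU)
  have hcomm : ∑ I, ∑ j, ∑ l, schwartzForm n (U (Fin.cons l I))
        ((-2 * Complex.I) • schwartzMul (leviForm ψ j l) (schwartzDx (U (Fin.cons j I))))
      = ∑ I : Fin m → Fin n, schwartzForm n (-∑ j, schwartzZ ψ j (U (Fin.cons j I)))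
          (-∑ j, schwartzZ ψ j (U (Fin.cons j I)))
        - ∑ j, ∑ l, ∑ I, schwartzForm n (schwartzZbar ψ l (U (Fin.cons j I)))
          (schwartzZbar ψ j (U (Fin.cons l I))) := by
    have hS : ∑ j, ∑ l, ∑ I : Fin m → Fin n, schwartzForm n (schwartzZbar ψ l (U (Fin.cons j I)))
          (schwartzZbar ψ j (U (Fin.cons l I)))
        = ∑ I : Fin m → Fin n, ∑ j, ∑ l, schwartzForm n (schwartzZbar ψ j (U (Fin.cons l I)))
          (schwartzZbar ψ l (U (Fin.cons j I))) := by
      simp_rw [Finset.sum_comm (s := Finset.univ (α := Fin n))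
        (t := Finset.univ (α := Fin m → Fin n))]
      exact Finset.sum_congr rfl fun I _ => Finset.sum_comm
    rw [hS, ← Finset.sum_sub_distrib]
    refine Finset.sum_congr rfl fun I _ => ?_
    simp only [map_neg, LinearMap.neg_apply, neg_neg, map_sum, LinearMap.sum_apply,
      Finset.sum_neg_distrib]
    rw [← Finset.sum_sub_distrib]
    refine Finset.sum_congr rfl fun j _ => ?_
    rw [← Finset.sum_sub_distrib]
    refine Finset.sum_congr rfl fun l _ => ?_
    rw [← schwartzZ_schwartzZbar_sub hψ, map_sub,
      schwartzForm_schwartzZ hψ j (U (Fin.cons l I)),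
      schwartzForm_schwartzZbar hψ l (U (Fin.cons l I)) (schwartzZ ψ j _)]
    ring
  rw [← hA] at hcomm
  have hS1 : ∑ j, ∑ J, schwartzForm n (schwartzZbar ψ j (U J)) (schwartzZbar ψ j (U J))
      = ((∑ j, ∑ J, ∫ p, ‖schwartzZbar ψ j (U J) p‖ ^ 2 : ℝ) : ℂ) := by
    simp [schwartzForm_self]
  rw [hS1] at hD
  rw [← Complex.re_sum, hcomm, Complex.sub_re, Complex.ofReal_re]
  have hm : (m + 1 : ℝ) ≠ 0 := by positivity
  have hm2 : (m + 2 : ℝ) ≠ 0 := by positivity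
  have hD' := congrArg Complex.re hD
  have hcast : (m + 2 : ℂ) = ((m + 2 : ℝ) : ℂ) := by push_cast; ring
  have hcast' : (m + 1 : ℂ) = ((m + 1 : ℝ) : ℂ) := by push_cast; ring
  rw [hcast, hcast', Complex.re_ofReal_mul, Complex.sub_re, Complex.re_ofReal_mul,
    Complex.ofReal_re, Complex.ofReal_re, Nat.factorial_succ, Nat.factorial_succ] at hD'
  push_cast at hD'
  field_simp
  refine mul_left_cancel₀ hm2 ?_
  linear_combination hD'

end Forms

end SchwartzOperators

theorem stmt_8 {n q' : ℕ} (hq : q' + 1 ≤ n)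
    (φ : (Fin n → ℂ) → ℝ) (hφ : ContDiff ℝ (⊤ : ℕ∞) φ)
    (ε : ℝ) (hε : 0 < ε) (t₀ : ℝ) (ht₀ : 0 < t₀)
    (hLevi : ∀ (z : Fin n → ℂ) (ξ : Fin n → ℂ),
      ε * ∑ j, ‖ξ j‖ ^ 2 ≤
        (∑ j, ∑ k, leviForm φ j k z * ξ j * (starRingEnd ℂ) (ξ k)).re)
    (u : (Fin (q' + 1) → Fin n) → ((Fin n → ℂ) × ℝ → ℂ))
    (hSchwartz : ∀ J, ∃ g : SchwartzMap ((Fin n → ℂ) × ℝ) ℂ, ⇑g = u J)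
    (hK : ∃ K : Set (Fin n → ℂ), IsCompact K ∧
      ∀ J, Function.support (u J) ⊆ K ×ˢ (Set.univ : Set ℝ))
    (hskew : ∀ (σ : Equiv.Perm (Fin (q' + 1))) (J : Fin (q' + 1) → Fin n)
      (p : (Fin n → ℂ) × ℝ),
      u (J ∘ σ) p = ((Equiv.Perm.sign σ : ℤ) : ℂ) * u J p)
    (hspec : ∀ (J : Fin (q' + 1) → Fin n) (z : Fin n → ℂ) (t : ℝ), t < t₀ →
      pft (u J) z t = 0) :
    formNormSq u
      ≤ (1 / (2 * (q' + 1 : ℝ) * ε * t₀)) *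
          (formNormSq (dbarb φ u) + formNormSq (dbarbAdj φ u)) := by
  obtain ⟨K, hK, hsupp⟩ := hK
  choose U hU using hSchwartz
  obtain rfl : (fun J => ⇑(U J)) = u := funext hU
  clear hU
  obtain ⟨ψ, hψ, hψφ⟩ := exists_isTest_eventuallyEq hφ hK
  have hzero : ∀ J, ∀ z ∉ K, ∀ x, U J (z, x) = 0 := fun J z hz x => by
    by_contra h
    exact hz (hsupp J h).1
  have hskewU : IsSkew U := fun σ J => SchwartzMap.ext fun p => hskew σ J p
  have hdbar : dbarb φ (fun J => ⇑(U J))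
      = fun K => ⇑(alternatingSum (fun j J => schwartzZbar ψ j (U J)) K) := by
    funext L p
    simp only [dbarb, alternatingSum, _root_.sum_apply, _root_.smul_apply,
      schwartzZbar_apply hψ, Zbar_congr hψφ (hzero _), smul_eq_mul]
  have hadj : dbarbAdj φ (fun J => ⇑(U J))
      = fun I => ⇑(-∑ j, schwartzZ ψ j (U (Fin.cons j I))) := by
    funext I p
    simp only [dbarbAdj, _root_.neg_apply, _root_.sum_apply, schwartzZ_apply hψ,
      Zorig_congr hψφ (hzero _)]
  have hlevi : ∀ z ∈ K, ∀ ξ : Fin n → ℂ, ε * ∑ j, ‖ξ j‖ ^ 2 ≤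
      (∑ j, ∑ l, leviForm ψ j l z * ξ j * (starRingEnd ℂ) (ξ l)).re := fun z hz ξ => by
    simpa only [leviForm_congr (hψφ z hz)] using hLevi z ξ
  have hcomm := Finset.sum_le_sum fun (I : Fin q' → Fin n) (_ : I ∈ Finset.univ) =>
    le_re_sum_schwartzForm_of_spectrum hψ hε.le ht₀.le hlevi (fun j => U (Fin.cons j I))
      (fun j => hzero _) (fun j => hspec _)
  have hBK := factorial_mul_formNormSq_add hψ hskewU
  have hnorm := factorial_mul_formNormSq hskewU
  rw [← Finset.mul_sum, Finset.sum_comm,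
    ← sum_fin_succ_pi fun J => ∫ p, ‖U J p‖ ^ 2, ← hnorm] at hcomm
  rw [hdbar, hadj]
  have hnonneg : 0 ≤ (∑ j, ∑ J, ∫ p, ‖schwartzZbar ψ j (U J) p‖ ^ 2) / (q' + 1 : ℝ) :=
    div_nonneg (Finset.sum_nonneg fun j _ => Finset.sum_nonneg fun J _ =>
      integral_nonneg fun p => by positivity) (by positivity)
  have hfac : (0 : ℝ) < q'.factorial := by positivity
  rw [Nat.factorial_succ] at hcomm
  push_cast at hcomm
  rw [div_mul_eq_mul_div, one_mul, le_div_iff₀ (by positivity)]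
  refine le_of_mul_le_mul_left ?_ hfac
  linarith
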